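/- Let E ⊂ ℝⁿ be m-rectifiable and Hᵐ-measurable with Hᵐ(E) < ∞. For every ε > 0 there exist finitely many compact embedded m-dimensional C¹ submanifolds with boundary M₁,…,M_N ⊂ ℝⁿ such that Hᵐ(E \ ⋃_j M_j) < ε and Hᵐ(⋃_j M_j \ E) < ε. -/

import Mathlib

open MeasureTheory Metric Set Filter ENNReal

noncomputable section

abbrev En (n : ℕ) := EuclideanSpace ℝ (Fin n)

/-- A set `E ⊆ ℝⁿ` is `m`-rectifiable if it is covered, up to an `Hᵐ`-null set,
by countably many Lipschitz images of `ℝᵐ`. -/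
def IsRectifiable (n m : ℕ) (E : Set (En n)) : Prop :=
  ∃ f : ℕ → EuclideanSpace ℝ (Fin m) → En n,
    (∀ i, ∃ L : NNReal, LipschitzWith L (f i)) ∧
    μH[m] (E \ ⋃ i, Set.range (f i)) = 0

/-- A set `U` is purely `m`-unrectifiable if `Hᵐ(U ∩ F) = 0` for every `m`-rectifiable `F`. -/
def PurelyUnrectifiable (n m : ℕ) (U : Set (En n)) : Prop :=
  ∀ F : Set (En n), IsRectifiable n m F → μH[m] (U ∩ F) = 0

/-- The model `m`-dimensional mslice in `ℝⁿ`: the coordinates of index `≥ m` vanish. -/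
def mslice (n m : ℕ) : Set (En n) := {y | ∀ i : Fin n, m ≤ (i : ℕ) → y i = 0}

/-- The model `m`-dimensional half-mslice: additionally the first coordinate is `≥ 0`. -/
def halfSlice (n m : ℕ) : Set (En n) :=
  mslice n m ∩ {y | ∀ i : Fin n, (i : ℕ) = 0 → 0 ≤ y i}

/-- `M ⊆ ℝⁿ` is an embedded `m`-dimensional `C¹` submanifold with boundary `B`:
every point of `M` has a `C¹` chart with `C¹` inverse flattening `M` onto the model
mslice (interior-type chart) or the model half-mslice (boundary-type chart), boundary
points corresponding exactly to the face of the half-mslice. -/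
def IsC1SubmanifoldWithBoundary (n m : ℕ) (M B : Set (En n)) : Prop :=
  B ⊆ M ∧ ∀ x ∈ M, ∃ (U : Set (En n)) (φ ψ : En n → En n),
    IsOpen U ∧ x ∈ U ∧ ContDiffOn ℝ 1 φ U ∧ IsOpen (φ '' U) ∧
    ContDiffOn ℝ 1 ψ (φ '' U) ∧ (∀ y ∈ U, ψ (φ y) = y) ∧
    ((φ '' (M ∩ U) = φ '' U ∩ mslice n m ∧ B ∩ U = ∅) ∨
      (φ '' (M ∩ U) = φ '' U ∩ halfSlice n m ∧
        φ '' (B ∩ U) = φ '' U ∩ {y ∈ mslice n m | ∀ i : Fin n, (i : ℕ) = 0 → y i = 0}))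

open scoped Convolution NNReal Topology

section Mollification

variable {G F : Type*} [NormedAddCommGroup G] [NormedSpace ℝ G] [FiniteDimensional ℝ G]
  [MeasurableSpace G] [BorelSpace G] [NormedAddCommGroup F] [NormedSpace ℝ F]
  [FiniteDimensional ℝ F] {μ : Measure G} [μ.IsAddHaarMeasure]

open ContinuousLinearMap (lsmul)

theorem ContDiffBump.integrable_normed_smul_comp_sub (φ : ContDiffBump (0 : G)) {f : G → F}
    (hf : Continuous f) (x : G) : Integrable (fun t ↦ φ.normed μ t • f (x - t)) μ := by
  exact (φ.hasCompactSupport_normed (μ := μ)).convolutionExists_left (L := lsmul ℝ ℝ) (μ := μ)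
    φ.continuous_normed hf.locallyIntegrable x

theorem ContDiffBump.norm_normed_convolution_sub_le (φ : ContDiffBump (0 : G)) {f : G → F}
    {L : ℝ≥0} (hf : LipschitzWith L f) (x : G) :
    ‖f x - (φ.normed μ ⋆[lsmul ℝ ℝ, μ] f) x‖ ≤ L * φ.rOut := by
  rw [← dist_eq_norm, dist_comm]
  refine φ.dist_normed_convolution_le hf.continuous.aestronglyMeasurable fun y hy ↦ ?_
  exact (hf.dist_le_mul y x).trans (by gcongr; exact (mem_ball.1 hy).le)

theorem ContDiffBump.normed_convolution_sub (φ : ContDiffBump (0 : G)) {f : G → F}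
    (hf : Continuous f) (x y : G) (c : F) :
    (φ.normed μ ⋆[lsmul ℝ ℝ, μ] f) x - (φ.normed μ ⋆[lsmul ℝ ℝ, μ] f) y - c =
      ∫ t, φ.normed μ t • (f (x - t) - f (y - t) - c) ∂μ := by
  have hx := φ.integrable_normed_smul_comp_sub (μ := μ) hf x
  have hy := φ.integrable_normed_smul_comp_sub (μ := μ) hf y
  have hc : Integrable (fun t ↦ φ.normed μ t • c) μ := φ.integrable_normed.smul_const c
  simp only [smul_sub]
  have hxy : Integrable (fun t ↦ φ.normed μ t • f (x - t) - φ.normed μ t • f (y - t)) μ := hx.sub hy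
  rw [integral_sub hxy hc, integral_sub hx hy, φ.integral_normed_smul μ c]
  rfl

theorem ContDiffBump.lipschitzWith_normed_convolution (φ : ContDiffBump (0 : G)) {f : G → F}
    {L : ℝ≥0} (hf : LipschitzWith L f) :
    LipschitzWith L (φ.normed μ ⋆[lsmul ℝ ℝ, μ] f) := by
  refine LipschitzWith.of_dist_le_mul fun x y ↦ ?_
  have h := φ.normed_convolution_sub (μ := μ) hf.continuous x y 0
  simp only [sub_zero] at h
  rw [dist_eq_norm, h]
  calc ‖∫ t, φ.normed μ t • (f (x - t) - f (y - t)) ∂μ‖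
      ≤ ∫ t, φ.normed μ t * (L * dist x y) ∂μ := by
        refine norm_integral_le_of_norm_le (φ.integrable_normed.mul_const _)
          (Eventually.of_forall fun t ↦ ?_)
        rw [norm_smul, Real.norm_of_nonneg (φ.nonneg_normed t), ← dist_eq_norm]
        gcongr
        · exact φ.nonneg_normed t
        · simpa using hf.dist_le_mul (x - t) (y - t)
    _ = L * dist x y := by rw [integral_mul_const, φ.integral_normed, one_mul]

/-- If `f` is `δ`-close to a linear map on `C`, then its mollification is almost as close to that
linear map between points at which `C` has mollified density close to one. -/
theorem ContDiffBump.norm_normed_convolution_sub_sub_le (φ : ContDiffBump (0 : G)) {f : G → F}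
    {L : ℝ≥0} (hf : LipschitzWith L f) {C : Set G} (hC : MeasurableSet C) {T : G →L[ℝ] F}
    (hT : ‖T‖ ≤ L) {δ : ℝ≥0} (hTC : ApproximatesLinearOn f T C δ) {κ : ℝ} {x y : G}
    (hx : 1 - κ ≤ (φ.normed μ ⋆[lsmul ℝ ℝ, μ] C.indicator (fun _ ↦ (1 : ℝ))) x)
    (hy : 1 - κ ≤ (φ.normed μ ⋆[lsmul ℝ ℝ, μ] C.indicator (fun _ ↦ (1 : ℝ))) y) :
    ‖(φ.normed μ ⋆[lsmul ℝ ℝ, μ] f) x - (φ.normed μ ⋆[lsmul ℝ ℝ, μ] f) y - T (x - y)‖ ≤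
      (δ + 4 * L * κ) * ‖x - y‖ := by
  set η := φ.normed μ
  set χ := C.indicator (fun _ ↦ (1 : ℝ)) with hχ
  have hloc : LocallyIntegrable χ μ :=
    (locallyIntegrable_const (1 : ℝ)).indicator hC
  have hint (z : G) : Integrable (fun t ↦ η t * χ (z - t)) μ :=
    φ.hasCompactSupport_normed.convolutionExists_left (L := lsmul ℝ ℝ) (μ := μ)
      φ.continuous_normed hloc z
  have hηi : Integrable η μ := φ.integrable_normed
  have hconv (z : G) : (η ⋆[lsmul ℝ ℝ, μ] χ) z = ∫ t, η t * χ (z - t) ∂μ := rfl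
  have hηx : Integrable (fun t ↦ η t * (δ + 4 * L) - 2 * L * (η t * χ (x - t))) μ :=
    (hηi.mul_const _).sub ((hint x).const_mul _)
  rw [φ.normed_convolution_sub hf.continuous]
  have hbound : ∀ t, ‖η t • (f (x - t) - f (y - t) - T (x - y))‖ ≤
      (η t * (δ + 4 * L) - 2 * L * (η t * χ (x - t)) - 2 * L * (η t * χ (y - t))) * ‖x - y‖ := by
    intro t
    have hη0 : 0 ≤ η t := φ.nonneg_normed t
    rw [norm_smul, Real.norm_of_nonneg hη0]
    have key : ‖f (x - t) - f (y - t) - T (x - y)‖ ≤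
        (δ + 4 * L - 2 * L * χ (x - t) - 2 * L * χ (y - t)) * ‖x - y‖ := by
      have triv : ‖f (x - t) - f (y - t) - T (x - y)‖ ≤ 2 * L * ‖x - y‖ := by
        have h1 : ‖f (x - t) - f (y - t)‖ ≤ L * ‖x - y‖ := by
          simpa using hf.norm_sub_le (x - t) (y - t)
        have h2 : ‖T (x - y)‖ ≤ L * ‖x - y‖ := T.le_of_opNorm_le hT _
        linarith [norm_sub_le (f (x - t) - f (y - t)) (T (x - y))]
      have hδ : 0 ≤ (δ : ℝ) * ‖x - y‖ := by positivity
      have hL : 0 ≤ (L : ℝ) * ‖x - y‖ := by positivity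
      by_cases h1 : x - t ∈ C <;> by_cases h2 : y - t ∈ C <;> simp only [hχ, indicator, h1, h2,
        if_true, if_false]
      · have := hTC _ h1 _ h2
        simp only [sub_sub_sub_cancel_right] at this
        linarith
      all_goals linarith
    calc η t * ‖f (x - t) - f (y - t) - T (x - y)‖
        ≤ η t * ((δ + 4 * L - 2 * L * χ (x - t) - 2 * L * χ (y - t)) * ‖x - y‖) := by gcongr
      _ = _ := by ring
  refine (norm_integral_le_of_norm_le ?_ (Eventually.of_forall hbound)).trans ?_
  · exact (hηx.sub ((hint y).const_mul _)).mul_const _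
  · rw [integral_mul_const, integral_sub hηx ((hint y).const_mul _),
      integral_sub (hηi.mul_const _) ((hint x).const_mul _),
      integral_mul_const, integral_const_mul, integral_const_mul, ← hconv, ← hconv,
      φ.integral_normed]
    gcongr
    nlinarith [L.coe_nonneg]

theorem tendsto_measure_normed_convolution_indicator_lt {φ : ℕ → ContDiffBump (0 : G)} {K : ℝ}
    (hφ : Tendsto (fun j ↦ (φ j).rOut) atTop (𝓝 0)) (hK : ∀ j, (φ j).rOut ≤ K * (φ j).rIn)
    {C : Set G} (hC : MeasurableSet C) (hCfin : μ C ≠ ∞) {κ : ℝ} (hκ : 0 < κ) :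
    Tendsto (fun j ↦ μ {x ∈ C |
      ((φ j).normed μ ⋆[lsmul ℝ ℝ, μ] C.indicator (fun _ ↦ (1 : ℝ))) x < 1 - κ}) atTop (𝓝 0) := by
  set χ := C.indicator (fun _ ↦ (1 : ℝ)) with hχ
  have hloc : LocallyIntegrable χ μ := (locallyIntegrable_const (1 : ℝ)).indicator hC
  have hae := ContDiffBump.ae_convolution_tendsto_right_of_locallyIntegrable hφ
    (Eventually.of_forall hK) hloc
  have : IsFiniteMeasure (μ.restrict C) := ⟨by simpa using hCfin.lt_top⟩
  have hmeas (j) : AEStronglyMeasurable ((φ j).normed μ ⋆[lsmul ℝ ℝ, μ] χ) (μ.restrict C) :=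
    ((φ j).hasCompactSupport_normed.continuous_convolution_left (lsmul ℝ ℝ)
      (φ j).continuous_normed hloc).aestronglyMeasurable
  have h := tendstoInMeasure_of_tendsto_ae hmeas (ae_restrict_of_ae hae)
    (ENNReal.ofReal κ) (by simpa using hκ)
  refine tendsto_of_tendsto_of_tendsto_of_le_of_le tendsto_const_nhds h (fun _ ↦ zero_le) ?_
  intro j
  simp only
  rw [Measure.restrict_apply' hC]
  refine measure_mono fun x hx ↦ ⟨?_, hx.1⟩
  have h1 : χ x = 1 := by simp [hχ, hx.1]
  simp only [mem_ofPred_eq, h1]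
  rw [edist_dist]
  refine ENNReal.ofReal_le_ofReal ?_
  rw [Real.dist_eq, abs_sub_comm]
  exact le_trans (by linarith [hx.2]) (le_abs_self _)

end Mollification

section Lusin

variable {G F : Type*} [NormedAddCommGroup G] [NormedSpace ℝ G] [FiniteDimensional ℝ G]
  [MeasurableSpace G] [BorelSpace G] [NormedAddCommGroup F] [NormedSpace ℝ F]
  [FiniteDimensional ℝ F] {μ : Measure G} [μ.IsAddHaarMeasure]

open scoped Function

theorem exists_measure_sdiff_biUnion_lt {α : Type*} [MeasurableSpace α] {ν : Measure α}
    {B : Set α} (hB : NullMeasurableSet B ν) (hBfin : ν B ≠ ∞) {C : ℕ → Set α}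
    (hC : ∀ i, NullMeasurableSet (C i) ν)
    {ε : ℝ≥0∞} (h : ν (B \ ⋃ i, C i) < ε) : ∃ N : ℕ, ν (B \ ⋃ i < N, C i) < ε := by
  have hanti : Antitone fun N : ℕ ↦ B \ ⋃ i < N, C i := fun a b hab ↦
    sdiff_subset_sdiff_right (biUnion_subset_biUnion_left fun i (hi : i < a) ↦ hi.trans_le hab)
  have hlim := tendsto_measure_iInter_atTop (μ := ν)
    (fun N ↦ hB.diff (NullMeasurableSet.biUnion (to_countable {i | i < N}) fun i _ ↦ hC i)) hanti
    ⟨0, ne_top_of_le_ne_top hBfin (measure_mono sdiff_subset)⟩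
  have heq : ⋂ N : ℕ, B \ ⋃ i < N, C i = B \ ⋃ i, C i := by
    ext x
    simp only [mem_iInter, Set.mem_sdiff, mem_iUnion, not_exists]
    exact ⟨fun hx ↦ ⟨(hx 0).1, fun i ↦ (hx (i + 1)).2 i (Nat.lt_succ_self i)⟩,
      fun hx N ↦ ⟨hx.1, fun i _ ↦ hx.2 i⟩⟩
  have hlim' : Tendsto (fun N : ℕ ↦ ν (B \ ⋃ i < N, C i)) atTop (𝓝 (ν (B \ ⋃ i, C i))) := by
    rw [← heq]; exact hlim
  exact (hlim'.eventually_lt_const h).exists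

/-- Most of a set of finite measure is covered by finitely many disjoint compact sets on each of
which a given Lipschitz map is close to linear. -/
theorem LipschitzWith.exists_compact_approximatesLinearOn {f : G → F} {L : ℝ≥0}
    (hf : LipschitzWith L f) {δ : ℝ≥0} (hδ : δ ≠ 0) {B : Set G} (hB : MeasurableSet B)
    (hBfin : μ B ≠ ∞) {ε : ℝ≥0∞} (hε : ε ≠ 0) :
    ∃ (N : ℕ) (C : ℕ → Set G) (T : ℕ → G →L[ℝ] F), (∀ i, IsCompact (C i)) ∧
      Pairwise (Disjoint on C) ∧ (∀ i, ‖T i‖ ≤ L) ∧ (∀ i, ApproximatesLinearOn f (T i) (C i) δ) ∧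
      μ (B \ ⋃ i < N, C i) < ε := by
  set s := {x | DifferentiableAt ℝ f x} with hs
  have hae : ∀ᵐ x ∂μ, x ∈ s := hf.ae_differentiableAt
  have hsm : MeasurableSet s := measurableSet_of_differentiableAt ℝ f
  obtain ⟨t, T, htd, htm, hst, hTt, hT⟩ :=
    exists_partition_approximatesLinearOn_of_hasFDerivWithinAt f s (fderiv ℝ f)
      (fun x hx ↦ (DifferentiableAt.hasFDerivAt hx).hasFDerivWithinAt) (fun _ ↦ δ) fun _ ↦ hδ
  obtain ⟨η, hη, hηε⟩ := ENNReal.exists_pos_sum_of_countable' hε ℕ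
  have hc (i : ℕ) := ((hB.inter (hsm.inter (htm i))).exists_isCompact_sdiff_lt (μ := μ)
    (ne_top_of_le_ne_top hBfin (measure_mono inter_subset_left)) (hη i).ne')
  choose C hCs hCc hCμ using hc
  have hlt : μ (B \ ⋃ i, C i) < ε := by
    have hsub : B \ ⋃ i, C i ⊆ sᶜ ∪ ⋃ i, ((B ∩ (s ∩ t i)) \ C i) := by
      rintro x ⟨hxB, hxC⟩
      by_cases hx : x ∈ s
      · obtain ⟨i, hi⟩ := mem_iUnion.1 (hst hx)
        exact Or.inr (mem_iUnion.2 ⟨i, ⟨hxB, hx, hi⟩, fun h ↦ hxC (mem_iUnion.2 ⟨i, h⟩)⟩)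
      · exact Or.inl hx
    calc μ (B \ ⋃ i, C i) ≤ μ sᶜ + μ (⋃ i, ((B ∩ (s ∩ t i)) \ C i)) :=
          (measure_mono hsub).trans (measure_union_le _ _)
      _ ≤ 0 + ∑' i, η i := by
          gcongr
          · exact (le_of_eq hae)
          · exact (measure_iUnion_le _).trans (ENNReal.tsum_le_tsum fun i ↦ (hCμ i).le)
      _ < ε := by rwa [zero_add]
  obtain ⟨N, hN⟩ := exists_measure_sdiff_biUnion_lt hB.nullMeasurableSet hBfin
    (fun i ↦ (hCc i).measurableSet.nullMeasurableSet) hlt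
  refine ⟨N, C, T, hCc, fun i j hij ↦ ?_, fun i ↦ ?_, fun i ↦ ?_, hN⟩
  · exact (htd hij).mono (fun x hx ↦ (hCs i hx).2.2) (fun x hx ↦ (hCs j hx).2.2)
  · obtain ⟨y, -, hy⟩ := hT hae.exists i
    rw [hy]
    exact norm_fderiv_le_of_lipschitz ℝ hf
  · exact (hTt i).mono_set fun x hx ↦ (hCs i hx).2

open ContinuousLinearMap (lsmul) in
/-- A Lipschitz map is, off a set of small measure, the sum of a `C¹` Lipschitz map and of a
Lipschitz map with small constant. -/
theorem LipschitzWith.exists_contDiff_add_lipschitzWith {f : G → F} {L : ℝ≥0}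
    (hf : LipschitzWith L f) {L' : ℝ≥0} (hL' : L' ≠ 0) {B : Set G} (hB : MeasurableSet B)
    (hBfin : μ B ≠ ∞) {ε : ℝ≥0∞} (hε : ε ≠ 0) :
    ∃ (g f' : G → F) (K : Set G), ContDiff ℝ 1 g ∧ LipschitzWith L g ∧ LipschitzWith L' f' ∧
      μ (B \ K) ≤ ε ∧ ∀ x ∈ K, f x = g x + f' x ∧ ‖f' x‖ ≤ L' := by
  set c := lipschitzExtensionConstant F
  set δ : ℝ≥0 := L' / (3 * c + 1) with hδdef
  have hδ : 0 < δ := by positivity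
  have hδc : c * (3 * δ) ≤ L' := by
    have : (3 * c + 1) * δ = L' := by rw [hδdef]; field_simp
    calc c * (3 * δ) = 3 * c * δ := by ring
      _ ≤ (3 * c + 1) * δ := by gcongr; exact le_self_add
      _ = L' := this
  have hδL : δ ≤ L' := div_le_self (zero_le) (le_add_self)
  set κ : ℝ := δ / (4 * L + 1) with hκdef
  have hκ : 0 < κ := by positivity
  have hκL : 4 * L * κ ≤ δ := by
    have : (4 * L + 1) * κ = δ := by rw [hκdef]; field_simp
    linarith
  obtain ⟨N, C, T, hCc, hCd, hTL, hTC, hBC⟩ :=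
    hf.exists_compact_approximatesLinearOn hδ.ne' hB hBfin (ENNReal.half_pos hε).ne'
  let φ : ℕ → ContDiffBump (0 : G) := fun j ↦
    ⟨1 / ((j : ℝ) + 1), 2 * (1 / ((j : ℝ) + 1)), by positivity, by
      have : (0 : ℝ) < 1 / ((j : ℝ) + 1) := by positivity
      linarith⟩
  have hφ : Tendsto (fun j ↦ (φ j).rOut) atTop (𝓝 0) := by
    have h := (tendsto_one_div_add_atTop_nhds_zero_nat (𝕜 := ℝ)).const_mul 2
    rwa [mul_zero] at h
  have hφK (j : ℕ) : (φ j).rOut ≤ 2 * (φ j).rIn := le_rfl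
  have hLφ : Tendsto (fun j ↦ L * (φ j).rOut) atTop (𝓝 0) := by simpa using hφ.const_mul (L : ℝ)
  obtain ⟨η, hη, hηε⟩ := ENNReal.exists_pos_sum_of_countable' (ENNReal.half_pos hε).ne' ℕ
  have hdens : ∀ᶠ j in atTop, ∀ i ∈ Finset.range N, μ {x ∈ C i |
      ((φ j).normed μ ⋆[lsmul ℝ ℝ, μ] (C i).indicator (fun _ ↦ (1 : ℝ))) x < 1 - κ} < η i :=
    (Finset.eventually_all _).2 fun i _ ↦
      (tendsto_measure_normed_convolution_indicator_lt hφ hφK (hCc i).measurableSet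
        (hCc i).measure_ne_top hκ).eventually_lt_const (hη i)
  have hsep : ∀ᶠ j in atTop, ∀ i ∈ Finset.range N, ∀ k ∈ Finset.range N, i ≠ k →
      ∀ x ∈ C i, ∀ y ∈ C k, 2 * (L * (φ j).rOut) ≤ δ * ‖x - y‖ := by
    refine (Finset.eventually_all _).2 fun i _ ↦ (Finset.eventually_all _).2 fun k _ ↦ ?_
    by_cases hik : i = k
    · exact Eventually.of_forall fun j h ↦ absurd hik h
    obtain ⟨r, hr, hrd⟩ := exists_pos_forall_lt_edist (hCc i) (hCc k).isClosed (hCd hik)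
    have hpos : (0 : ℝ) < δ * r / 2 := by positivity
    filter_upwards [hLφ.eventually_lt_const hpos] with j hj _ x hx y hy
    have h1 : (r : ℝ) < ‖x - y‖ := by
      have := hrd x hx y hy
      rw [edist_nndist, ENNReal.coe_lt_coe] at this
      rw [← dist_eq_norm]
      exact_mod_cast this
    have h2 : (δ : ℝ) * r ≤ δ * ‖x - y‖ := by gcongr
    linarith
  obtain ⟨j, hjd, hjs, hjL⟩ := (hdens.and (hsep.and (hLφ.eventually_lt_const
    (NNReal.coe_pos.2 hδ)))).exists
  set g := (φ j).normed μ ⋆[lsmul ℝ ℝ, μ] f with hg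
  let D : ℕ → Set G := fun i ↦ {x ∈ C i |
    1 - κ ≤ ((φ j).normed μ ⋆[lsmul ℝ ℝ, μ] (C i).indicator (fun _ ↦ (1 : ℝ))) x}
  have hfg (x : G) : ‖f x - g x‖ ≤ L * (φ j).rOut := (φ j).norm_normed_convolution_sub_le hf x
  have hlip : LipschitzOnWith (3 * δ) (fun x ↦ f x - g x) (⋃ i < N, D i) := by
    refine LipschitzOnWith.of_dist_le_mul fun x hx y hy ↦ ?_
    simp only [mem_iUnion] at hx hy
    obtain ⟨i, hi, hxi⟩ := hx
    obtain ⟨k, hk, hyk⟩ := hy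
    rw [dist_eq_norm, dist_eq_norm]
    push_cast
    have hδxy : 0 ≤ (δ : ℝ) * ‖x - y‖ := by positivity
    by_cases hik : i = k
    · subst hik
      have h1 := hTC i x hxi.1 y hyk.1
      have h2 := (φ j).norm_normed_convolution_sub_sub_le hf (hCc i).measurableSet (hTL i) (hTC i)
        hxi.2 hyk.2
      have h3 : (δ + 4 * L * κ) * ‖x - y‖ ≤ (δ + δ) * ‖x - y‖ := by gcongr
      have h4 := _root_.norm_sub_le (f x - f y - T i (x - y)) (g x - g y - T i (x - y))
      have h5 : f x - g x - (f y - g y) =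
        f x - f y - T i (x - y) - (g x - g y - T i (x - y)) := by abel
      rw [h5]
      linarith
    · have h1 := hjs i (Finset.mem_range.2 hi) k (Finset.mem_range.2 hk) hik x hxi.1 y hyk.1
      linarith [_root_.norm_sub_le (f x - g x) (f y - g y), hfg x, hfg y]
  obtain ⟨f', hf', hff'⟩ := hlip.extend_finite_dimension
  refine ⟨g, f', ⋃ i < N, D i, ?_, (φ j).lipschitzWith_normed_convolution hf, hf'.weaken hδc, ?_,
    fun x hx ↦ ?_⟩
  · exact (φ j).hasCompactSupport_normed.contDiff_convolution_left (n := 1) _ (φ j).contDiff_normed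
      hf.continuous.locallyIntegrable
  · have hsub : B \ ⋃ i < N, D i ⊆ (B \ ⋃ i < N, C i) ∪ ⋃ i ∈ Finset.range N, {x ∈ C i |
        ((φ j).normed μ ⋆[lsmul ℝ ℝ, μ] (C i).indicator (fun _ ↦ (1 : ℝ))) x < 1 - κ} := by
      rintro x ⟨hxB, hxD⟩
      by_cases hx : x ∈ ⋃ i < N, C i
      · right
        simp only [mem_iUnion] at hx hxD ⊢
        obtain ⟨i, hi, hxi⟩ := hx
        refine ⟨i, Finset.mem_range.2 hi, hxi, ?_⟩
        by_contra hcon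
        exact hxD ⟨i, hi, hxi, not_lt.1 hcon⟩
      · exact Or.inl ⟨hxB, hx⟩
    calc μ (B \ ⋃ i < N, D i) ≤ ε / 2 + ∑ i ∈ Finset.range N, η i := by
          refine (measure_mono hsub).trans ((measure_union_le _ _).trans ?_)
          gcongr
          exact (measure_biUnion_finset_le _ _).trans (Finset.sum_le_sum fun i hi ↦ (hjd i hi).le)
      _ ≤ ε / 2 + ε / 2 := by
          gcongr
          exact (ENNReal.sum_le_tsum _).trans hηε.le
      _ = ε := ENNReal.add_halves ε
  · have h := hff' hx
    simp only at h
    refine ⟨by rw [← h]; abel, ?_⟩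
    rw [← h]
    exact (hfg x).trans (hjL.le.trans (by exact_mod_cast hδL))

/-- A Lipschitz map coincides with a `C¹` Lipschitz map off a set of small measure. -/
theorem LipschitzWith.exists_contDiff_measure_ne_le {f : G → F} {L : ℝ≥0}
    (hf : LipschitzWith L f) {B : Set G} (hB : MeasurableSet B)
    (hBfin : μ B ≠ ∞) {ε : ℝ≥0∞} (hε : ε ≠ 0) :
    ∃ g : G → F, ContDiff ℝ 1 g ∧ (∃ L' : ℝ≥0, LipschitzWith L' g) ∧
      μ (B \ {x | f x = g x}) ≤ ε := by
  let l : ℕ → ℝ≥0 := fun j ↦ (L + 1) * (1 / 2) ^ j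
  have hlpos (j : ℕ) : l j ≠ 0 := by positivity
  have hlsum : Summable l := by
    refine Summable.mul_left _ (NNReal.summable_geometric ?_)
    rw [div_lt_one] <;> norm_num
  have hlsum' : Summable fun j ↦ (l j : ℝ) := NNReal.summable_coe.2 hlsum
  obtain ⟨η, hη, hηε⟩ := ENNReal.exists_pos_sum_of_countable' hε ℕ
  have hstep (j : ℕ) (h : {h : G → F // LipschitzWith (l j) h}) :=
    h.2.exists_contDiff_add_lipschitzWith (μ := μ) (hlpos (j + 1)) hB hBfin (hη j).ne'
  choose g' r' K' hgC hgL hrL hKμ hK using hstep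
  let fs : ∀ j, {h : G → F // LipschitzWith (l j) h} := fun j ↦
    Nat.rec ⟨f, hf.weaken (by simp [l])⟩ (fun j h ↦ ⟨r' j h, hrL j h⟩) j
  let g : ℕ → G → F := fun j ↦ g' j (fs j)
  let S : Set G := ⋂ j, K' j (fs j)
  have hrec (j : ℕ) (x : G) (hx : x ∈ S) :
      (fs j).1 x = g j x + (fs (j + 1)).1 x ∧ ‖(fs (j + 1)).1 x‖ ≤ l (j + 1) :=
    hK j (fs j) x (mem_iInter.1 hx j)
  have hS : μ (B \ S) ≤ ε := by
    rw [show B \ S = ⋃ j, B \ K' j (fs j) from sdiff_iInter _ _]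
    exact (measure_iUnion_le _).trans
      ((ENNReal.tsum_le_tsum fun j ↦ hKμ j (fs j)).trans hηε.le)
  have hnorm (x : G) (hx : x ∈ S) : Summable fun j ↦ ‖(fs j).1 x‖ :=
    (summable_nat_add_iff 1).1 <| Summable.of_nonneg_of_le (fun _ ↦ norm_nonneg _)
      (fun j ↦ (hrec j x hx).2) ((summable_nat_add_iff 1).2 hlsum')
  have hgsum (x : G) (hx : x ∈ S) : Summable fun j ↦ g j x := by
    refine Summable.of_norm_bounded ((hnorm x hx).add ((summable_nat_add_iff 1).2 (hnorm x hx)))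
      fun j ↦ ?_
    rw [show g j x = (fs j).1 x - (fs (j + 1)).1 x by rw [(hrec j x hx).1]; abel]
    exact _root_.norm_sub_le _ _
  have hpartial (x : G) (hx : x ∈ S) (j : ℕ) :
      ∑ i ∈ Finset.range j, g i x = f x - (fs j).1 x := by
    induction j with
    | zero => simp [fs]
    | succ j ih => rw [Finset.sum_range_succ, ih, (hrec j x hx).1]; abel
  have heq (x : G) (hx : x ∈ S) : f x = ∑' j, g j x := by
    refine tendsto_nhds_unique ?_ (hgsum x hx).hasSum.tendsto_sum_nat
    simp only [hpartial x hx]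
    simpa using tendsto_const_nhds.sub
      (tendsto_zero_iff_norm_tendsto_zero.2 (hnorm x hx).tendsto_atTop_zero)
  rcases S.eq_empty_or_nonempty with hSe | ⟨x₀, hx₀⟩
  · refine ⟨fun _ ↦ 0, contDiff_const, ⟨0, LipschitzWith.const 0⟩, ?_⟩
    rw [hSe, sdiff_empty] at hS
    exact (measure_mono sdiff_subset).trans hS
  have hgd (j : ℕ) (x : G) : HasFDerivAt (g j) (fderiv ℝ (g j) x) x :=
    ((hgC j (fs j)).differentiable one_ne_zero x).hasFDerivAt
  have hgb (j : ℕ) (x : G) : ‖fderiv ℝ (g j) x‖ ≤ l j :=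
    norm_fderiv_le_of_lipschitz ℝ (hgL j (fs j))
  have hd (x : G) := hasFDerivAt_tsum hlsum' hgd hgb (hgsum x₀ hx₀) x
  refine ⟨fun x ↦ ∑' j, g j x, ?_, ⟨∑' j, l j, ?_⟩, ?_⟩
  · refine contDiff_one_iff_fderiv.2 ⟨fun x ↦ (hd x).differentiableAt, ?_⟩
    rw [show fderiv ℝ (fun x ↦ ∑' j, g j x) = fun x ↦ ∑' j, fderiv ℝ (g j) x from
      funext fun x ↦ (hd x).fderiv]
    exact continuous_tsum (fun j ↦ (hgC j (fs j)).continuous_fderiv one_ne_zero) hlsum' hgb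
  · refine lipschitzWith_of_nnnorm_fderiv_le (𝕜 := ℝ) (fun x ↦ (hd x).differentiableAt) fun x ↦ ?_
    rw [(hd x).fderiv, ← NNReal.coe_le_coe, coe_nnnorm, NNReal.coe_tsum]
    exact tsum_of_norm_bounded hlsum'.hasSum fun j ↦ hgb j x
  · exact (measure_mono (sdiff_subset_sdiff_right fun x hx ↦ heq x hx)).trans hS

/-- A Lipschitz map coincides almost everywhere with one of countably many `C¹` Lipschitz maps. -/
theorem LipschitzWith.exists_seq_contDiff_ae_eq (μ : Measure G) [μ.IsAddHaarMeasure] {f : G → F}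
    {L : ℝ≥0} (hf : LipschitzWith L f) :
    ∃ g : ℕ → G → F, (∀ k, ContDiff ℝ 1 (g k)) ∧ (∀ k, ∃ L' : ℝ≥0, LipschitzWith L' (g k)) ∧
      ∀ᵐ x ∂μ, ∃ k, f x = g k x := by
  have h (p : ℕ × ℕ) := hf.exists_contDiff_measure_ne_le (μ := μ) (B := closedBall 0 p.1)
    isClosed_closedBall.measurableSet measure_closedBall_lt_top.ne
    (ε := ((p.2 : ℝ≥0∞) + 1)⁻¹) (by simp)
  choose g hgC hgL hg using h
  refine ⟨fun k ↦ g k.unpair, fun k ↦ hgC _, fun k ↦ hgL _, ?_⟩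
  have hball (R : ℕ) : μ (closedBall 0 R \ {x | ∃ p, f x = g p x}) = 0 := by
    refine le_antisymm (ge_of_tendsto' (x := atTop)
      (ENNReal.tendsto_inv_nat_nhds_zero.comp (tendsto_add_atTop_nat 1)) fun j ↦ ?_) zero_le
    have hsub : {x | f x = g (R, j) x} ⊆ {x | ∃ p, f x = g p x} := fun x hx ↦ ⟨(R, j), hx⟩
    simpa using (measure_mono (sdiff_subset_sdiff_right hsub)).trans (hg (R, j))
  refine measure_mono_null (fun x hx ↦ ?_) (measure_iUnion_null hball)
  obtain ⟨R, hR⟩ := exists_nat_ge ‖x‖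
  refine mem_iUnion.2 ⟨R, by simpa using hR, fun ⟨p, hp⟩ ↦ hx ⟨Nat.pair p.1 p.2, ?_⟩⟩
  simpa using hp

end Lusin

section Hausdorff

instance isAddHaarMeasure_hausdorffMeasure_euclideanSpace (m : ℕ) :
    (μH[(m : ℝ)] : Measure (EuclideanSpace ℝ (Fin m))).IsAddHaarMeasure := by
  simpa using isAddHaarMeasure_hausdorffMeasure (E := EuclideanSpace ℝ (Fin m))

theorem LipschitzWith.hausdorffMeasure_image_null {X Y : Type*} [EMetricSpace X] [EMetricSpace Y]
    [MeasurableSpace X] [BorelSpace X] [MeasurableSpace Y] [BorelSpace Y] {f : X → Y} {K : ℝ≥0}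
    (hf : LipschitzWith K f) {d : ℝ} (hd : 0 ≤ d) {s : Set X} (hs : μH[d] s = 0) :
    μH[d] (f '' s) = 0 :=
  le_antisymm ((hf.hausdorffMeasure_image_le hd s).trans (by simp [hs])) zero_le

variable {m : ℕ} {F : Type*} [NormedAddCommGroup F] [NormedSpace ℝ F] [MeasurableSpace F]
  [BorelSpace F]

open scoped RealInnerProductSpace in
/-- A map which is `δ`-close to a linear map with nontrivial kernel contracts `m`-dimensional
measure by a factor comparable to `δ`. -/
theorem ApproximatesLinearOn.hausdorffMeasure_image_le_of_apply_eq_zero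
    {f : EuclideanSpace ℝ (Fin m) → F} {T : EuclideanSpace ℝ (Fin m) →L[ℝ] F}
    {A : Set (EuclideanSpace ℝ (Fin m))} {δ L : ℝ≥0} (hf : ApproximatesLinearOn f T A δ)
    (hδ : 0 < δ) (hδ1 : δ ≤ 1) (hT : ‖T‖ ≤ L) {v : EuclideanSpace ℝ (Fin m)} (hv : ‖v‖ = 1)
    (hTv : T v = 0) :
    μH[m] (f '' A) ≤ ((L + 2 : ℝ≥0) : ℝ≥0∞) ^ (m : ℝ) * (δ * μH[m] A) := by
  let S : EuclideanSpace ℝ (Fin m) →ₗ[ℝ] EuclideanSpace ℝ (Fin m) :=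
    LinearMap.transvection (innerₛₗ ℝ v) (((δ : ℝ) - 1) • v)
  have hvv : ⟪v, v⟫ = 1 := by rw [real_inner_self_eq_norm_sq, hv, one_pow]
  have hSapp (z) : S z = z + ⟪v, z⟫ • (((δ : ℝ) - 1) • v) := by
    simp [S, LinearMap.transvection.apply]
  have hdet : LinearMap.det S = δ := by
    simp only [S, LinearMap.transvection.det, map_smul, innerₛₗ_apply_apply, hvv, smul_eq_mul]
    ring
  have hinner (z) : ⟪v, S z⟫ = δ * ⟪v, z⟫ := by
    rw [hSapp, inner_add_right, inner_smul_right, inner_smul_right, hvv]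
    ring
  have hproj (z : EuclideanSpace ℝ (Fin m)) : ‖z - ⟪v, z⟫ • v‖ ≤ ‖z‖ := by
    refine abs_le_of_sq_le_sq' ?_ (norm_nonneg _) |>.2
    rw [norm_sub_sq_real, inner_smul_right, norm_smul, hv, mul_one, Real.norm_eq_abs, sq_abs,
      real_inner_comm]
    nlinarith [sq_nonneg ⟪v, z⟫]
  have hP (z) : z - ⟪v, z⟫ • v = S z - ⟪v, S z⟫ • v := by
    rw [hinner, hSapp]
    module
  have hPS (z) : ‖z - ⟪v, z⟫ • v‖ ≤ ‖S z‖ := by rw [hP]; exact hproj _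
  have hTz (z) : ‖T z‖ ≤ L * ‖S z‖ := by
    have h : T z = T (z - ⟪v, z⟫ • v) := by simp [hTv]
    rw [h]
    exact (T.le_of_opNorm_le hT _).trans (by gcongr; exact hPS z)
  have hz (z) : δ * ‖z‖ ≤ 2 * ‖S z‖ := by
    have h1 : ‖z‖ ≤ ‖z - ⟪v, z⟫ • v‖ + |⟪v, z⟫| := by
      have := norm_add_le (z - ⟪v, z⟫ • v) (⟪v, z⟫ • v)
      rwa [sub_add_cancel, norm_smul, hv, mul_one, Real.norm_eq_abs] at this
    have h2 : δ * |⟪v, z⟫| ≤ ‖S z‖ := by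
      have := abs_real_inner_le_norm v (S z)
      rwa [hinner, abs_mul, hv, one_mul, abs_of_nonneg δ.coe_nonneg] at this
    have h3 : (δ : ℝ) * ‖z - ⟪v, z⟫ • v‖ ≤ ‖S z‖ :=
      (mul_le_of_le_one_left (norm_nonneg _) (by exact_mod_cast hδ1)).trans (hPS z)
    have h4 : (δ : ℝ) * ‖z‖ ≤ δ * (‖z - ⟪v, z⟫ • v‖ + |⟪v, z⟫|) := by gcongr
    linarith
  have hSinj : Function.Injective S := by
    refine (injective_iff_map_eq_zero S).2 fun z hz0 ↦ ?_
    have h := hz z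
    rw [hz0, norm_zero, mul_zero] at h
    have hδ' : (0 : ℝ) < δ := hδ
    exact norm_le_zero_iff.1 (nonpos_of_mul_nonpos_right h hδ')
  have hinv (z) : Function.invFun S (S z) = z := Function.leftInverse_invFun hSinj z
  have hlip : LipschitzOnWith (L + 2) (f ∘ Function.invFun S) (S '' A) := by
    refine LipschitzOnWith.of_dist_le_mul ?_
    rintro _ ⟨x, hx, rfl⟩ _ ⟨y, hy, rfl⟩
    simp only [Function.comp, hinv, dist_eq_norm, ← map_sub]
    push_cast
    have h1 := hf x hx y hy
    have h2 := norm_add_le (f x - f y - T (x - y)) (T (x - y))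
    rw [sub_add_cancel] at h2
    linarith [hTz (x - y), hz (x - y)]
  have himg : f '' A = (f ∘ Function.invFun S) '' (S '' A) := by
    rw [image_image]
    simp [hinv]
  rw [himg]
  refine (hlip.hausdorffMeasure_image_le (Nat.cast_nonneg m)).trans (le_of_eq ?_)
  rw [Measure.addHaar_image_linearMap, hdet, abs_of_nonneg δ.coe_nonneg, ENNReal.ofReal_coe_nnreal]

variable [FiniteDimensional ℝ F]

theorem LipschitzWith.hausdorffMeasure_image_not_injective_fderiv
    {f : EuclideanSpace ℝ (Fin m) → F} {L : ℝ≥0} (hf : LipschitzWith L f) :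
    μH[m] (f '' {x | DifferentiableAt ℝ f x ∧ ¬ Function.Injective (fderiv ℝ f x)}) = 0 := by
  set s := {x | DifferentiableAt ℝ f x ∧ ¬ Function.Injective (fderiv ℝ f x)} with hs
  have hbound (R : ℕ) (δ : ℝ≥0) (hδ : 0 < δ) (hδ1 : δ ≤ 1) : μH[m] (f '' (s ∩ ball 0 R)) ≤
      ((L + 2 : ℝ≥0) : ℝ≥0∞) ^ (m : ℝ) *
        (δ * μH[m] (ball (0 : EuclideanSpace ℝ (Fin m)) R)) := by
    rcases s.eq_empty_or_nonempty with hse | hne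
    · simp [hse]
    obtain ⟨t, T, htd, htm, hst, hTt, hT⟩ :=
      exists_partition_approximatesLinearOn_of_hasFDerivWithinAt f s (fderiv ℝ f)
        (fun x hx ↦ hx.1.hasFDerivAt.hasFDerivWithinAt) (fun _ ↦ δ) fun _ ↦ hδ.ne'
    have hpiece (i : ℕ) : μH[m] (f '' (s ∩ t i ∩ ball 0 R)) ≤
        ((L + 2 : ℝ≥0) : ℝ≥0∞) ^ (m : ℝ) * (δ * μH[m] (t i ∩ ball 0 R)) := by
      obtain ⟨y, hy, hTy⟩ := hT hne i
      have hTL : ‖T i‖ ≤ L := by rw [hTy]; exact norm_fderiv_le_of_lipschitz ℝ hf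
      obtain ⟨w, hw, hw0⟩ : ∃ w, T i w = 0 ∧ w ≠ 0 := by
        have h := hy.2
        rw [← hTy, injective_iff_map_eq_zero] at h
        push Not at h
        exact h
      refine (((hTt i).mono_set inter_subset_left).hausdorffMeasure_image_le_of_apply_eq_zero hδ
        hδ1 hTL (v := ‖w‖⁻¹ • w) (norm_smul_inv_norm hw0) (by simp [hw])).trans ?_
      gcongr
      exact inter_subset_right
    have hsub : f '' (s ∩ ball 0 R) ⊆ ⋃ i, f '' (s ∩ t i ∩ ball 0 R) := by
      rintro _ ⟨x, ⟨hx, hxR⟩, rfl⟩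
      obtain ⟨i, hi⟩ := mem_iUnion.1 (hst hx)
      exact mem_iUnion.2 ⟨i, x, ⟨⟨hx, hi⟩, hxR⟩, rfl⟩
    calc μH[m] (f '' (s ∩ ball 0 R))
        ≤ ∑' i, ((L + 2 : ℝ≥0) : ℝ≥0∞) ^ (m : ℝ) * (δ * μH[m] (t i ∩ ball 0 R)) :=
          (measure_mono hsub).trans ((measure_iUnion_le _).trans (ENNReal.tsum_le_tsum hpiece))
      _ = ((L + 2 : ℝ≥0) : ℝ≥0∞) ^ (m : ℝ) * (δ * μH[m] (⋃ i, t i ∩ ball 0 R)) := by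
          rw [ENNReal.tsum_mul_left, ENNReal.tsum_mul_left, measure_iUnion
            (fun i j hij ↦ (htd hij).mono inter_subset_left inter_subset_left)
            fun i ↦ (htm i).inter measurableSet_ball]
      _ ≤ _ := by
          gcongr
          exact iUnion_subset fun i ↦ inter_subset_right
  have hball (R : ℕ) : μH[m] (f '' (s ∩ ball 0 R)) = 0 := by
    have hfin : μH[m] (ball (0 : EuclideanSpace ℝ (Fin m)) R) ≠ ∞ := measure_ball_lt_top.ne
    have hlim : Tendsto (fun j : ℕ ↦ ((L + 2 : ℝ≥0) : ℝ≥0∞) ^ (m : ℝ) *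
        ((((j : ℝ≥0) + 1)⁻¹ : ℝ≥0) * μH[m] (ball (0 : EuclideanSpace ℝ (Fin m)) R))) atTop
        (𝓝 (((L + 2 : ℝ≥0) : ℝ≥0∞) ^ (m : ℝ) *
          ((0 : ℝ≥0) * μH[m] (ball (0 : EuclideanSpace ℝ (Fin m)) R)))) := by
      refine ENNReal.Tendsto.const_mul (ENNReal.Tendsto.mul_const ?_ (Or.inr hfin)) (Or.inr ?_)
      · refine ENNReal.tendsto_coe.2 ?_
        simpa using tendsto_one_div_add_atTop_nhds_zero_nat (𝕜 := ℝ≥0)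
      · exact ENNReal.rpow_ne_top_of_nonneg (Nat.cast_nonneg m) ENNReal.coe_ne_top
    refine le_antisymm ((ge_of_tendsto' hlim fun j ↦ ?_).trans (by simp)) zero_le
    exact hbound R _ (by positivity) (inv_le_one_of_one_le₀ (by simp))
  refine measure_mono_null ?_ (measure_iUnion_null hball)
  rintro _ ⟨x, hx, rfl⟩
  obtain ⟨R, hR⟩ := exists_nat_gt ‖x‖
  exact mem_iUnion.2 ⟨R, x, ⟨hx, by simpa using hR⟩, rfl⟩

end Hausdorff

section Graphs

/-- `γ` parametrizes an entire Lipschitz `C¹` graph: it is the restriction to the model slice of a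
global `C¹` diffeomorphism of `ℝⁿ`, and is bi-Lipschitz onto its image. -/
def IsGraphParam (n m : ℕ) (γ : En m → En n) : Prop :=
  (∃ L : ℝ≥0, LipschitzWith L γ) ∧
  (∃ (p : En n → En m) (L : ℝ≥0), LipschitzWith L p ∧ Function.LeftInverse p γ) ∧
  ∃ (ι : En m →ₗᵢ[ℝ] En n) (Φ Ψ : En n → En n), range ι = mslice n m ∧
    ContDiff ℝ 1 Φ ∧ ContDiff ℝ 1 Ψ ∧ Function.LeftInverse Ψ Φ ∧ Function.RightInverse Ψ Φ ∧
    ∀ x, γ x = Φ (ι x)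

/-- `E` is covered, up to an `Hᵐ`-null set, by countably many entire Lipschitz `C¹` graphs. -/
def IsGraphCovered (n m : ℕ) (E : Set (En n)) : Prop :=
  ∃ S : Set (En m → En n), S.Countable ∧ (∀ γ ∈ S, IsGraphParam n m γ) ∧
    μH[m] (E \ ⋃ γ ∈ S, range γ) = 0

theorem IsGraphCovered.of_null {n m : ℕ} {E : Set (En n)} (hE : μH[m] E = 0) :
    IsGraphCovered n m E :=
  ⟨∅, countable_empty, by simp, by simpa using hE⟩

theorem IsGraphCovered.mono {n m : ℕ} {E E' : Set (En n)} (h : IsGraphCovered n m E)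
    (hE : E' ⊆ E) : IsGraphCovered n m E' := by
  obtain ⟨S, hS, hSγ, hSE⟩ := h
  exact ⟨S, hS, hSγ, measure_mono_null (sdiff_subset_sdiff_left hE) hSE⟩

theorem IsGraphCovered.iUnion {n m : ℕ} {E : ℕ → Set (En n)} (h : ∀ i, IsGraphCovered n m (E i)) :
    IsGraphCovered n m (⋃ i, E i) := by
  choose S hS hSγ hSE using h
  refine ⟨⋃ i, S i, countable_iUnion hS, fun γ hγ ↦ ?_, ?_⟩
  · obtain ⟨i, hi⟩ := mem_iUnion.1 hγ
    exact hSγ i γ hi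
  · refine measure_mono_null ?_ (measure_iUnion_null hSE)
    rintro x ⟨hx, hxS⟩
    obtain ⟨i, hi⟩ := mem_iUnion.1 hx
    refine mem_iUnion.2 ⟨i, hi, fun hxi ↦ hxS ?_⟩
    simp only [mem_iUnion] at hxi ⊢
    obtain ⟨γ, hγ, hxγ⟩ := hxi
    exact ⟨γ, ⟨i, hγ⟩, hxγ⟩

theorem IsGraphCovered.union {n m : ℕ} {E E' : Set (En n)} (h : IsGraphCovered n m E)
    (h' : IsGraphCovered n m E') : IsGraphCovered n m (E ∪ E') := by
  have := IsGraphCovered.iUnion (m := m) (E := fun i : ℕ ↦ if i = 0 then E else E')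
    fun i ↦ by by_cases hi : i = 0 <;> simp [hi, h, h']
  refine this.mono ?_
  rintro x (hx | hx)
  · exact mem_iUnion.2 ⟨0, by simpa using hx⟩
  · exact mem_iUnion.2 ⟨1, by simpa using hx⟩

theorem exists_linearIsometry_range_eq_mslice {n m : ℕ} (h : m ≤ n) :
    ∃ ι : En m →ₗᵢ[ℝ] En n, range ι = mslice n m := by
  let l : En m →ₗ[ℝ] En n :=
    { toFun := fun x ↦ WithLp.toLp 2 fun i ↦ if hi : (i : ℕ) < m then x ⟨i, hi⟩ else 0
      map_add' := fun x y ↦ by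
        ext i
        by_cases hi : (i : ℕ) < m <;> simp [hi]
      map_smul' := fun c x ↦ by
        ext i
        by_cases hi : (i : ℕ) < m <;> simp [hi] }
  have happ (x : En m) (i : Fin n) : l x i = if hi : (i : ℕ) < m then x ⟨i, hi⟩ else 0 := rfl
  refine ⟨⟨l, fun x ↦ ?_⟩, ?_⟩
  · rw [EuclideanSpace.norm_eq, EuclideanSpace.norm_eq]
    congr 1
    symm
    refine Fintype.sum_of_injective (Fin.castLE h) (Fin.castLE_injective h) _ _ ?_ ?_
    · intro i hi
      have him : ¬ (i : ℕ) < m := fun him ↦ hi ⟨⟨i, him⟩, rfl⟩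
      simp [happ, him]
    · intro i
      simp [happ]
  · ext y
    constructor
    · rintro ⟨x, rfl⟩ i hi
      exact dif_neg (not_lt.2 hi)
    · intro hy
      refine ⟨WithLp.toLp 2 fun i ↦ y (Fin.castLE h i), ?_⟩
      ext i
      change l _ i = y i
      rw [happ]
      by_cases hi : (i : ℕ) < m
      · simp [hi]
      · rw [dif_neg hi, hy i (not_lt.1 hi)]

theorem exists_linearEquiv_comp_eq {K V W : Type*} [Field K] [AddCommGroup V] [Module K V]
    [AddCommGroup W] [Module K W] [FiniteDimensional K W] {a b : V →ₗ[K] W}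
    (ha : Function.Injective a) (hb : Function.Injective b) :
    ∃ e : W ≃ₗ[K] W, ∀ v, e (a v) = b v := by
  obtain ⟨p, hp⟩ := Submodule.exists_isCompl (LinearMap.range a)
  obtain ⟨q, hq⟩ := Submodule.exists_isCompl (LinearMap.range b)
  let i : LinearMap.range a ≃ₗ[K] LinearMap.range b :=
    (LinearEquiv.ofInjective a ha).symm.trans (LinearEquiv.ofInjective b hb)
  have hpq : Module.finrank K p = Module.finrank K q := by
    have h1 := Submodule.finrank_add_eq_of_isCompl hp
    have h2 := Submodule.finrank_add_eq_of_isCompl hq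
    have h3 := i.finrank_eq
    omega
  refine ⟨(Submodule.prodEquivOfIsCompl _ _ hp).symm.trans ((i.prodCongr
    (LinearEquiv.ofFinrankEq p q hpq)).trans (Submodule.prodEquivOfIsCompl _ _ hq)), fun v ↦ ?_⟩
  have h1 : (Submodule.prodEquivOfIsCompl _ _ hp).symm (a v) =
      (LinearEquiv.ofInjective a ha v, 0) := by
    rw [LinearEquiv.symm_apply_eq]
    simp
  simp [h1, i]

variable {n m : ℕ}

theorem isGraphParam_add {T : En m →L[ℝ] En n} {π : En n →L[ℝ] En m} (hπ : ∀ x, π (T x) = x)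
    {W : En m → En n} (hW : ContDiff ℝ 1 W) {L : ℝ≥0} (hWL : LipschitzWith L W)
    (hπW : ∀ x, π (W x) = 0) : IsGraphParam n m fun x ↦ T x + W x := by
  have hT : Function.Injective T := Function.LeftInverse.injective hπ
  have hmn : m ≤ n := by
    simpa using LinearMap.finrank_le_finrank_of_injective (f := T.toLinearMap) hT
  obtain ⟨ι, hι⟩ := exists_linearIsometry_range_eq_mslice hmn
  obtain ⟨e, he⟩ := exists_linearEquiv_comp_eq (a := ι.toLinearMap) (b := T.toLinearMap)
    ι.injective hT
  let R : En n ≃L[ℝ] En n := e.toContinuousLinearEquiv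
  have hR (x : En m) : R (ι x) = T x := he x
  refine ⟨⟨_, T.lipschitz.add hWL⟩, ⟨π, _, π.lipschitz, fun x ↦ by simp [hπ, hπW]⟩, ι,
    fun y ↦ R y + W (π (R y)), fun z ↦ R.symm (z - W (π z)), hι, ?_, ?_, fun y ↦ ?_, fun z ↦ ?_,
    fun x ↦ ?_⟩
  · exact R.contDiff.add (hW.comp (π.contDiff.comp R.contDiff))
  · exact R.symm.contDiff.comp (contDiff_id.sub (hW.comp π.contDiff))
  · simp [hπW]
  · simp [hπW]
  · simp [hR, hπ]

/-- The image under a Lipschitz map of a set on which it is close to an injective linear map is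
covered by `C¹` graphs. -/
theorem isGraphCovered_image_of_approximatesLinearOn {f : En m → En n} {L : ℝ≥0}
    (hf : LipschitzWith L f) {T : En m →L[ℝ] En n} {π : En n →L[ℝ] En m} (hπ : ∀ x, π (T x) = x)
    {c : ℝ≥0} (hc : ‖π‖ * c ≤ 1 / 2) {A : Set (En m)} (hA : ApproximatesLinearOn f T A c) :
    IsGraphCovered n m (f '' A) := by
  let p : En m → En m := fun x ↦ π (f x)
  have hp (x) (hx : x ∈ A) (y) (hy : y ∈ A) : ‖x - y‖ ≤ 2 * ‖p x - p y‖ := by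
    have h1 : ‖p x - p y - (x - y)‖ ≤ 1 / 2 * ‖x - y‖ := by
      have : p x - p y - (x - y) = π (f x - f y - T (x - y)) := by simp [p, hπ]
      rw [this]
      calc ‖π (f x - f y - T (x - y))‖ ≤ ‖π‖ * (c * ‖x - y‖) :=
            (π.le_opNorm _).trans (by gcongr; exact hA x hx y hy)
        _ = ‖π‖ * c * ‖x - y‖ := by ring
        _ ≤ _ := by gcongr
    have h2 := norm_sub_norm_le (x - y) (p x - p y)
    rw [norm_sub_rev (x - y)] at h2
    linarith
  have hpinj : InjOn p A := fun x hx y hy hxy ↦ by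
    have h := hp x hx y hy
    rw [hxy, sub_self, norm_zero, mul_zero] at h
    exact sub_eq_zero.1 (norm_le_zero_iff.1 h)
  have hinv (x) (hx : x ∈ A) : Function.invFunOn p A (p x) = x := hpinj.leftInvOn_invFunOn hx
  have hlip : LipschitzOnWith (L * 2 + ‖T‖₊) (fun z ↦ f (Function.invFunOn p A z) - T z)
      (p '' A) := by
    refine LipschitzOnWith.sub (hf.comp_lipschitzOnWith ?_) T.lipschitz.lipschitzOnWith
    refine LipschitzOnWith.of_dist_le_mul ?_
    rintro _ ⟨x, hx, rfl⟩ _ ⟨y, hy, rfl⟩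
    rw [hinv x hx, hinv y hy, dist_eq_norm, dist_eq_norm]
    exact hp x hx y hy
  obtain ⟨U, hU, hUeq⟩ := hlip.extend_finite_dimension
  obtain ⟨g, hgC, hgL, hg⟩ := hU.exists_seq_contDiff_ae_eq μH[m]
  let Q : En n →L[ℝ] En n := ContinuousLinearMap.id ℝ (En n) - T.comp π
  have hQ (y) : Q y = y - T (π y) := rfl
  have hUp (x) (hx : x ∈ A) : f x = T (p x) + Q (U (p x)) := by
    have h : f (Function.invFunOn p A (p x)) - T (p x) = U (p x) := hUeq ⟨x, hx, rfl⟩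
    rw [hinv x hx] at h
    rw [hQ, ← h]
    simp [p, hπ]
  refine ⟨range fun k x ↦ T x + Q (g k x), countable_range _, ?_, ?_⟩
  · rintro _ ⟨k, rfl⟩
    obtain ⟨L', hL'⟩ := hgL k
    exact isGraphParam_add hπ (Q.contDiff.comp (hgC k)) (Q.lipschitz.comp hL')
      fun x ↦ by simp [hQ, hπ]
  · have hnull := (T.lipschitz.add (Q.lipschitz.comp hU)).hausdorffMeasure_image_null
      (Nat.cast_nonneg m) (ae_iff.1 hg)
    refine measure_mono_null ?_ hnull
    rintro _ ⟨⟨x, hx, rfl⟩, hxg⟩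
    refine ⟨p x, ?_, (hUp x hx).symm⟩
    rintro ⟨k, hk⟩
    refine hxg ?_
    simp only [mem_iUnion]
    exact ⟨_, ⟨k, rfl⟩, p x, by simp only [← hk, ← hUp x hx]⟩

theorem LipschitzWith.isGraphCovered_range {f : En m → En n} {L : ℝ≥0} (hf : LipschitzWith L f) :
    IsGraphCovered n m (range f) := by
  have hleft (T : En m →L[ℝ] En n) : ∃ π : En n →L[ℝ] En m,
      Function.Injective T → ∀ x, π (T x) = x := by
    by_cases hT : Function.Injective T
    · obtain ⟨g, hg⟩ := T.toLinearMap.exists_leftInverse_of_injective (LinearMap.ker_eq_bot.2 hT)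
      exact ⟨LinearMap.toContinuousLinearMap g, fun _ x ↦ LinearMap.congr_fun hg x⟩
    · exact ⟨0, fun h ↦ absurd h hT⟩
  choose π hπ using hleft
  set s := {x | DifferentiableAt ℝ f x ∧ Function.Injective (fderiv ℝ f x)} with hs
  have hinj : IsGraphCovered n m (f '' s) := by
    rcases s.eq_empty_or_nonempty with hse | hne
    · exact .of_null (by simp [hse])
    obtain ⟨t, T, -, -, hst, hTt, hT⟩ :=
      exists_partition_approximatesLinearOn_of_hasFDerivWithinAt f s (fderiv ℝ f)
        (fun x hx ↦ hx.1.hasFDerivAt.hasFDerivWithinAt) (fun T ↦ (2 * (‖π T‖₊ + 1))⁻¹)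
        fun T ↦ by positivity
    have hpiece (i : ℕ) : IsGraphCovered n m (f '' (s ∩ t i)) := by
      obtain ⟨y, hy, hTy⟩ := hT hne i
      refine isGraphCovered_image_of_approximatesLinearOn hf (hπ (T i) ?_) ?_ (hTt i)
      · rw [hTy]; exact hy.2
      · push_cast
        rw [← div_eq_mul_inv, div_le_div_iff₀ (by positivity) (by positivity)]
        linarith
    refine (IsGraphCovered.iUnion hpiece).mono ?_
    rw [← image_iUnion, ← inter_iUnion]
    exact image_mono fun x hx ↦ ⟨hx, hst hx⟩
  have hdiff : IsGraphCovered n m (f '' {x | ¬ DifferentiableAt ℝ f x}) :=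
    .of_null (hf.hausdorffMeasure_image_null (Nat.cast_nonneg m) hf.ae_differentiableAt)
  refine ((hinj.union hdiff).union
    (.of_null hf.hausdorffMeasure_image_not_injective_fderiv)).mono ?_
  rintro _ ⟨x, rfl⟩
  by_cases h1 : DifferentiableAt ℝ f x
  · by_cases h2 : Function.Injective (fderiv ℝ f x)
    · exact Or.inl (Or.inl ⟨x, ⟨h1, h2⟩, rfl⟩)
    · exact Or.inr ⟨x, ⟨h1, h2⟩, rfl⟩
  · exact Or.inl (Or.inr ⟨x, h1, rfl⟩)

theorem IsRectifiable.isGraphCovered {E : Set (En n)} (h : IsRectifiable n m E) :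
    IsGraphCovered n m E := by
  obtain ⟨f, hf, hE⟩ := h
  refine ((IsGraphCovered.iUnion fun i ↦ ?_).union (.of_null hE)).mono
    (E := (⋃ i, range (f i)) ∪ (E \ ⋃ i, range (f i))) fun x hx ↦ ?_
  · obtain ⟨L, hL⟩ := hf i
    exact hL.isGraphCovered_range
  · by_cases h : x ∈ ⋃ i, range (f i)
    · exact Or.inl h
    · exact Or.inr ⟨hx, h⟩

end Graphs

section Charts

variable {n m : ℕ}

/-- The pair `(M, B)` admits near `x` a chart as in the definition of a `C¹` submanifold with
boundary. -/
def HasC1Chart (n m : ℕ) (M B : Set (En n)) (x : En n) : Prop :=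
  ∃ (U : Set (En n)) (φ ψ : En n → En n),
    IsOpen U ∧ x ∈ U ∧ ContDiffOn ℝ 1 φ U ∧ IsOpen (φ '' U) ∧
    ContDiffOn ℝ 1 ψ (φ '' U) ∧ (∀ y ∈ U, ψ (φ y) = y) ∧
    ((φ '' (M ∩ U) = φ '' U ∩ mslice n m ∧ B ∩ U = ∅) ∨
      (φ '' (M ∩ U) = φ '' U ∩ halfSlice n m ∧
        φ '' (B ∩ U) = φ '' U ∩ {y ∈ mslice n m | ∀ i : Fin n, (i : ℕ) = 0 → y i = 0}))

theorem HasC1Chart.image {M B : Set (En n)} {x : En n} (h : HasC1Chart n m M B x)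
    {Φ Ψ : En n → En n} (hΦ : ContDiff ℝ 1 Φ) (hΨ : ContDiff ℝ 1 Ψ)
    (hl : Function.LeftInverse Ψ Φ) (hr : Function.RightInverse Ψ Φ) :
    HasC1Chart n m (Φ '' M) (Φ '' B) (Φ x) := by
  obtain ⟨U, φ, ψ, hU, hxU, hφ, hφU, hψ, hinv, hflat⟩ := h
  have himage : ∀ S : Set (En n), (φ ∘ Ψ) '' (Φ '' S) = φ '' S := fun S ↦ by
    rw [image_image]
    exact image_congr fun y _ ↦ by simp [hl y]
  have hinter : ∀ S : Set (En n), Φ '' S ∩ Φ '' U = Φ '' (S ∩ U) := fun S ↦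
    (image_inter hl.injective).symm
  refine ⟨Φ '' U, φ ∘ Ψ, Φ ∘ ψ, ?_, mem_image_of_mem _ hxU, ?_, ?_, ?_, ?_, ?_⟩
  · rw [image_eq_preimage_of_inverse hl hr]
    exact hU.preimage hΨ.continuous
  · refine hφ.comp hΨ.contDiffOn ?_
    rintro _ ⟨y, hy, rfl⟩
    rwa [hl y]
  · rwa [himage]
  · rw [himage]
    exact hΦ.comp_contDiffOn hψ
  · rintro _ ⟨y, hy, rfl⟩
    simp [hl y, hinv y hy]
  · simpa only [hinter, himage, image_eq_empty] using hflat

theorem image_inter_eq_inter_of_mem_iff {α β : Type*} {f : α → β} {s u : Set α} {t : Set β}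
    (h : ∀ x ∈ u, x ∈ s ↔ f x ∈ t) : f '' (s ∩ u) = f '' u ∩ t := by
  ext y
  constructor
  · rintro ⟨x, ⟨hs, hu⟩, rfl⟩
    exact ⟨⟨x, hu, rfl⟩, (h x hu).1 hs⟩
  · rintro ⟨⟨x, hu, rfl⟩, ht⟩
    exact ⟨x, ⟨(h x hu).2 ht, hu⟩, rfl⟩

/-- The unit ball of the model slice is flattened near the points with positive first coordinate
by the map replacing the first coordinate `y₀` by `1 - ‖y‖ ^ 2`. -/
theorem hasC1Chart_unitBall_of_pos (hm : 0 < m) {k : Fin n} (hk : (k : ℕ) = 0) {x : En n}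
    (hx : 0 < x k) :
    HasC1Chart n m (mslice n m ∩ closedBall 0 1) (mslice n m ∩ sphere 0 1) x := by
  set e : En n := EuclideanSpace.single k 1 with he
  have hself : ∀ (y : En n) (t : ℝ), (y + (t - y k) • e) k = t := fun y t ↦ by simp [he]
  have hother : ∀ (y : En n) (t : ℝ) (i : Fin n), i ≠ k → (y + (t - y k) • e) i = y i :=
    fun y t i hi ↦ by simp [he, hi]
  have hnorm : ∀ (y : En n) (t : ℝ),
      ‖y + (t - y k) • e‖ ^ 2 = ‖y‖ ^ 2 - y k ^ 2 + t ^ 2 := fun y t ↦ by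
    rw [norm_add_sq_real, norm_smul, inner_smul_right, he, EuclideanSpace.inner_single_right]
    simp
    ring
  have hcoord : ContDiff ℝ 1 fun y : En n ↦ y k := by fun_prop
  have hsq : ContDiff ℝ 1 fun y : En n ↦ ‖y‖ ^ 2 := contDiff_norm_sq ℝ
  let φ : En n → En n := fun y ↦ y + ((1 - ‖y‖ ^ 2) - y k) • e
  let c : En n → ℝ := fun z ↦ 1 - z k - (‖z‖ ^ 2 - z k ^ 2)
  let ψ : En n → En n := fun z ↦ z + (√(c z) - z k) • e
  have hc : ContDiff ℝ 1 c := by fun_prop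
  have hcφ : ∀ y, c (φ y) = y k ^ 2 := fun y ↦ by
    simp only [c, φ, hself, hnorm]
    ring
  have hinv : ∀ y : En n, 0 < y k → ψ (φ y) = y := fun y hy ↦ by
    simp only [ψ, hcφ, Real.sqrt_sq hy.le]
    simp only [φ, hself, add_assoc, ← add_smul]
    simp
  have himage : φ '' {y | 0 < y k} = {z | 0 < c z} := by
    ext z
    constructor
    · rintro ⟨y, hy, rfl⟩
      change 0 < c (φ y)
      rw [hcφ]
      exact pow_pos hy 2
    · intro hz
      replace hz : 0 < c z := hz
      have hzk : ψ z k = √(c z) := hself z _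
      refine ⟨ψ z, ?_, ?_⟩
      · change 0 < ψ z k
        rw [hzk]
        exact Real.sqrt_pos.2 hz
      · have h1 : 1 - ‖ψ z‖ ^ 2 = z k := by
          simp only [ψ, hnorm, Real.sq_sqrt hz.le, c]
          ring
        simp only [φ, h1, hzk]
        simp only [ψ, add_assoc, ← add_smul]
        simp
  have hslice : ∀ y, φ y ∈ mslice n m ↔ y ∈ mslice n m := fun y ↦ by
    refine forall_congr' fun i ↦ imp_congr_right fun hi ↦ ?_
    rw [show φ y i = y i from hother y _ i (by rintro rfl; omega)]
  have hfirst : ∀ (p : ℝ → Prop) (y : En n),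
      (∀ i : Fin n, (i : ℕ) = 0 → p (φ y i)) ↔ p (1 - ‖y‖ ^ 2) := fun p y ↦ by
    have hφk : φ y k = 1 - ‖y‖ ^ 2 := hself y _
    refine ⟨fun h ↦ hφk ▸ h k hk, fun h i hi ↦ ?_⟩
    rwa [show i = k from Fin.ext (hi.trans hk.symm), hφk]
  refine ⟨{y | 0 < y k}, φ, ψ, isOpen_lt continuous_const hcoord.continuous, hx, ?_, ?_, ?_,
    hinv, Or.inr ⟨?_, ?_⟩⟩
  · exact ContDiff.contDiffOn (by fun_prop)
  · rw [himage]
    exact isOpen_lt continuous_const hc.continuous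
  · rw [himage]
    have hsqrt : ContDiffOn ℝ 1 (fun z ↦ √(c z)) {z | 0 < c z} :=
      hc.contDiffOn.sqrt fun z hz ↦ (show 0 < c z from hz).ne'
    exact contDiffOn_id.add ((hsqrt.sub hcoord.contDiffOn).smul contDiffOn_const)
  · refine image_inter_eq_inter_of_mem_iff fun y _ ↦ ?_
    change y ∈ mslice n m ∧ y ∈ closedBall 0 1 ↔
      φ y ∈ mslice n m ∧ ∀ i : Fin n, (i : ℕ) = 0 → 0 ≤ φ y i
    rw [hslice, hfirst (0 ≤ ·), mem_closedBall_zero_iff, sub_nonneg,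
      sq_le_one_iff₀ (norm_nonneg y)]
  · refine image_inter_eq_inter_of_mem_iff fun y _ ↦ ?_
    change y ∈ mslice n m ∧ y ∈ sphere 0 1 ↔
      φ y ∈ mslice n m ∧ ∀ i : Fin n, (i : ℕ) = 0 → φ y i = 0
    rw [hslice, hfirst (· = 0), mem_sphere_zero_iff_norm, sub_eq_zero, eq_comm (a := (1 : ℝ)),
      pow_eq_one_iff_of_nonneg (norm_nonneg y) two_ne_zero]

theorem hasC1Chart_unitBall_of_linearIsometryEquiv (R : En n ≃ₗᵢ[ℝ] En n)
    (hR : ∀ y, R y ∈ mslice n m ↔ y ∈ mslice n m) {x : En n}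
    (h : HasC1Chart n m (mslice n m ∩ closedBall 0 1) (mslice n m ∩ sphere 0 1) (R x)) :
    HasC1Chart n m (mslice n m ∩ closedBall 0 1) (mslice n m ∩ sphere 0 1) x := by
  have := h.image (Φ := R.symm) (Ψ := R) R.symm.contDiff R.contDiff R.apply_symm_apply
    R.symm_apply_apply
  have hs : R.symm '' mslice n m = mslice n m := by
    ext y
    rw [R.symm.image_eq_preimage_symm]
    exact hR y
  simpa [image_inter R.symm.injective, hs] using this

theorem isC1SubmanifoldWithBoundary_unitBall :
    IsC1SubmanifoldWithBoundary n m (mslice n m ∩ closedBall 0 1) (mslice n m ∩ sphere 0 1) := by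
  refine ⟨inter_subset_inter_right _ sphere_subset_closedBall, fun x hx ↦ ?_⟩
  change HasC1Chart n m _ _ x
  rcases (mem_closedBall_zero_iff.1 hx.2).lt_or_eq with hlt | heq
  · refine ⟨ball 0 1, id, id, isOpen_ball, by simpa using hlt, contDiffOn_id, by simp,
      contDiffOn_id, fun _ _ ↦ rfl, Or.inl ⟨?_, ?_⟩⟩
    · simp only [image_id]
      rw [inter_assoc, inter_eq_right.2 ball_subset_closedBall, inter_comm]
    · rw [inter_assoc, sphere_disjoint_ball.inter_eq, inter_empty]
  · obtain ⟨i, hi⟩ : ∃ i, x i ≠ 0 := by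
      by_contra! h
      have : x = 0 := by ext i; simpa using h i
      simp [this] at heq
    have him : (i : ℕ) < m := by
      by_contra! h
      exact hi (hx.1 i h)
    let k : Fin n := ⟨0, i.pos⟩
    have hm : 0 < m := by omega
    let R := LinearIsometryEquiv.piLpCongrLeft 2 ℝ ℝ (Equiv.swap k i)
    have hRapply : ∀ (y : En n) j, R y j = y (Equiv.swap k i j) := fun y j ↦ by
      simp [R, LinearIsometryEquiv.piLpCongrLeft_apply]
    have hR : ∀ y, R y ∈ mslice n m ↔ y ∈ mslice n m := fun y ↦ by
      refine forall_congr' fun j ↦ imp_congr_right fun hj ↦ ?_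
      rw [hRapply, Equiv.swap_apply_of_ne_of_ne]
      · rintro rfl
        exact absurd hj (by simp [k]; omega)
      · rintro rfl
        omega
    refine hasC1Chart_unitBall_of_linearIsometryEquiv R hR ?_
    have hRk : R x k = x i := by rw [hRapply, Equiv.swap_apply_left]
    rcases hi.lt_or_gt with hneg | hpos
    · refine hasC1Chart_unitBall_of_linearIsometryEquiv (LinearIsometryEquiv.neg ℝ)
        (fun y ↦ by simp [mslice]) (hasC1Chart_unitBall_of_pos hm (k := k) rfl ?_)
      simpa [hRk] using hneg
    · exact hasC1Chart_unitBall_of_pos hm (k := k) rfl (by rwa [hRk])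

theorem IsGraphParam.isC1SubmanifoldWithBoundary {γ : En m → En n} (hγ : IsGraphParam n m γ)
    (a : En m) {r : ℝ} (hr : 0 < r) :
    IsC1SubmanifoldWithBoundary n m (γ '' closedBall a r) (γ '' sphere a r) := by
  obtain ⟨-, -, ι, Φ, Ψ, hι, hΦ, hΨ, hl, hr', hγι⟩ := hγ
  let T : En n → En n := fun y ↦ ι a + r • y
  let T' : En n → En n := fun y ↦ r⁻¹ • (y - ι a)
  have hT : ContDiff ℝ 1 T := by fun_prop
  have hT' : ContDiff ℝ 1 T' := by fun_prop
  have hlT : Function.LeftInverse T' T := fun y ↦ by simp [T, T', hr.ne']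
  have hrT : Function.RightInverse T' T := fun y ↦ by simp [T, T', hr.ne']
  have hball : ∀ (s : Set (En n)) (t : Set (En m)), (∀ x, a + r • x ∈ t ↔ ι x ∈ s) →
      γ '' t = (Φ ∘ T) '' (mslice n m ∩ s) := fun s t hst ↦ by
    ext y
    constructor
    · rintro ⟨x, hx, rfl⟩
      have hx' : a + r • (r⁻¹ • (x - a)) = x := by simp [hr.ne']
      refine ⟨ι (r⁻¹ • (x - a)), ⟨hι ▸ mem_range_self _, (hst _).1 (by rwa [hx'])⟩, ?_⟩
      rw [hγι]
      conv_rhs => rw [← hx']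
      simp [T]
    · rintro ⟨z, ⟨hz, hzs⟩, rfl⟩
      obtain ⟨x, rfl⟩ := hι ▸ hz
      exact ⟨a + r • x, (hst x).2 hzs, by simp [hγι, T]⟩
  have hnorm : ∀ x : En m, dist (a + r • x) a = r * ‖ι x‖ := fun x ↦ by
    simp [dist_eq_norm, norm_smul, abs_of_pos hr]
  have h1 := hball (closedBall 0 1) (closedBall a r) fun x ↦ by
    rw [mem_closedBall, hnorm, mem_closedBall_zero_iff, mul_le_iff_le_one_right hr]
  have h2 := hball (sphere 0 1) (sphere a r) fun x ↦ by
    rw [mem_sphere, hnorm, mem_sphere_zero_iff_norm, mul_eq_left₀ hr.ne']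
  refine ⟨image_mono sphere_subset_closedBall, ?_⟩
  rw [h1, h2]
  rintro _ ⟨x, hx, rfl⟩
  exact HasC1Chart.image (isC1SubmanifoldWithBoundary_unitBall.2 x hx) (hΦ.comp hT)
    (hT'.comp hΨ) (hl.comp hlT) (hr'.comp hrT)

end Charts

section Approximation

variable {n m : ℕ}

/-- The part of `E` lying on a parametrised graph is covered by countably many images of balls
which exceed `E` by little. -/
theorem IsGraphParam.exists_countable_cover {γ : En m → En n} (hγ : IsGraphParam n m γ)
    {E : Set (En n)} (hE : MeasurableSet E) (hfin : μH[m] E < ⊤) {η : ℝ≥0∞} (hη : η ≠ 0) :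
    ∃ 𝓕 : Set (Set (En n)), 𝓕.Countable ∧
      (∀ M ∈ 𝓕, IsCompact M ∧ ∃ B, IsC1SubmanifoldWithBoundary n m M B) ∧
      E ∩ range γ ⊆ ⋃₀ 𝓕 ∧ μH[m] (⋃₀ 𝓕 \ E) ≤ η := by
  obtain ⟨⟨L, hL⟩, ⟨p, L', hL', hp⟩, -⟩ := id hγ
  have hm : (0 : ℝ) ≤ m := Nat.cast_nonneg m
  have hAfin : μH[m] (γ ⁻¹' E) ≠ ⊤ := by
    refine ne_top_of_le_ne_top (mul_ne_top (rpow_ne_top_of_nonneg hm coe_ne_top) hfin.ne)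
      ((measure_mono fun x hx ↦ ?_).trans (hL'.hausdorffMeasure_image_le hm E))
    exact ⟨γ x, hx, hp x⟩
  have hδ : η / (L : ℝ≥0∞) ^ (m : ℝ) ≠ 0 :=
    ENNReal.div_ne_zero.2 ⟨hη, rpow_ne_top_of_nonneg hm coe_ne_top⟩
  obtain ⟨O, hAO, hO, -, hOA⟩ :=
    (hL.continuous.measurable hE).exists_isOpen_sdiff_lt hAfin hδ
  have hball : ∀ x, ∃ r, 0 < r ∧ (x ∈ O → closedBall x r ⊆ O) := fun x ↦ by
    by_cases hx : x ∈ O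
    · obtain ⟨r, hr, hrO⟩ := nhds_basis_closedBall.mem_iff.1 (hO.mem_nhds hx)
      exact ⟨r, hr, fun _ ↦ hrO⟩
    · exact ⟨1, one_pos, fun h ↦ absurd h hx⟩
  choose r hr hrO using hball
  obtain ⟨t, htO, ht, hcover⟩ := TopologicalSpace.countable_cover_nhdsWithin (s := O)
    (f := fun x ↦ closedBall x (r x))
    fun x _ ↦ mem_nhdsWithin_of_mem_nhds (closedBall_mem_nhds x (hr x))
  refine ⟨(fun x ↦ γ '' closedBall x (r x)) '' t, ht.image _, ?_, ?_, ?_⟩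
  · rintro _ ⟨x, -, rfl⟩
    exact ⟨(isCompact_closedBall x (r x)).image hL.continuous, _,
      hγ.isC1SubmanifoldWithBoundary x (hr x)⟩
  · rintro _ ⟨hxE, x, rfl⟩
    obtain ⟨y, hy, hxy⟩ := mem_iUnion₂.1 (hcover (hAO hxE))
    exact ⟨_, mem_image_of_mem _ hy, mem_image_of_mem _ hxy⟩
  · calc μH[m] (⋃₀ ((fun x ↦ γ '' closedBall x (r x)) '' t) \ E)
        ≤ μH[m] (γ '' (O \ γ ⁻¹' E)) := by
          refine measure_mono ?_
          rintro _ ⟨⟨_, ⟨y, hy, rfl⟩, x, hx, rfl⟩, hxE⟩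
          exact ⟨x, ⟨hrO y (htO hy) hx, hxE⟩, rfl⟩
      _ ≤ (L : ℝ≥0∞) ^ (m : ℝ) * μH[m] (O \ γ ⁻¹' E) := hL.hausdorffMeasure_image_le hm _
      _ ≤ (L : ℝ≥0∞) ^ (m : ℝ) * (η / (L : ℝ≥0∞) ^ (m : ℝ)) := by gcongr
      _ ≤ η := ENNReal.mul_div_le

theorem isC1SubmanifoldWithBoundary_empty : IsC1SubmanifoldWithBoundary n m ∅ ∅ :=
  ⟨Subset.rfl, fun _ hx ↦ absurd hx (notMem_empty _)⟩

end Approximation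

theorem stmt13 (n m : ℕ) (E : Set (En n)) (hE : MeasurableSet E)
    (hfin : μH[m] E < ⊤) (hrect : IsRectifiable n m E) :
    ∀ ε : ℝ, 0 < ε →
      ∃ (N : ℕ) (Ms : Fin N → Set (En n)),
        (∀ j, IsCompact (Ms j) ∧
          ∃ Bj : Set (En n), IsC1SubmanifoldWithBoundary n m (Ms j) Bj) ∧
        μH[m] (E \ ⋃ j, Ms j) < ENNReal.ofReal ε ∧
        μH[m] ((⋃ j, Ms j) \ E) < ENNReal.ofReal ε := by
  intro ε hε
  have hε' : ENNReal.ofReal ε ≠ 0 := (ENNReal.ofReal_pos.2 hε).ne'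
  obtain ⟨S, hS, hSγ, hnull⟩ := hrect.isGraphCovered
  have := hS.to_subtype
  obtain ⟨η, hη, hηsum⟩ := ENNReal.exists_pos_sum_of_countable' hε' S
  choose 𝓕 h𝓕 h𝓕M hcover hexcess using fun γ : S ↦
    (hSγ γ γ.2).exists_countable_cover hE hfin (hη γ).ne'
  obtain ⟨M, hM⟩ := ((countable_iUnion h𝓕).insert ∅).exists_eq_range (insert_nonempty _ _)
  have hMc : ∀ i, IsCompact (M i) ∧ ∃ B, IsC1SubmanifoldWithBoundary n m (M i) B := fun i ↦ by
    rcases hM ▸ mem_range_self i with h | h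
    · rw [h]
      exact ⟨isCompact_empty, ∅, isC1SubmanifoldWithBoundary_empty⟩
    · obtain ⟨γ, hγ⟩ := mem_iUnion.1 h
      exact h𝓕M γ _ hγ
  have hMU : ⋃ i, M i = ⋃ γ, ⋃₀ 𝓕 γ := by
    rw [← sUnion_range, ← hM, sUnion_insert, empty_union, sUnion_iUnion]
  have hlt : μH[m] (E \ ⋃ i, M i) < ENNReal.ofReal ε := by
    refine (measure_mono_null ?_ hnull).trans_lt (ENNReal.ofReal_pos.2 hε)
    refine fun x hx ↦ ⟨hx.1, fun hxS ↦ hx.2 ?_⟩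
    obtain ⟨γ, hγ, hxγ⟩ := mem_iUnion₂.1 hxS
    rw [hMU]
    exact mem_iUnion.2 ⟨⟨γ, hγ⟩, hcover ⟨γ, hγ⟩ ⟨hx.1, hxγ⟩⟩
  obtain ⟨N, hN⟩ := exists_measure_sdiff_biUnion_lt hE.nullMeasurableSet hfin.ne
    (fun i ↦ (hMc i).1.measurableSet.nullMeasurableSet) hlt
  have hFin : ⋃ j : Fin N, M j = ⋃ i < N, M i := by
    ext x
    simp [Fin.exists_iff]
  refine ⟨N, fun j ↦ M j, fun j ↦ hMc j, by rwa [hFin], ?_⟩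
  calc μH[m] ((⋃ j : Fin N, M j) \ E) ≤ μH[m] (⋃ γ, ⋃₀ 𝓕 γ \ E) := by
        rw [← iUnion_sdiff, ← hMU]
        exact measure_mono (sdiff_subset_sdiff_left (iUnion_subset fun j ↦ subset_iUnion M j))
    _ ≤ ∑' γ, η γ := (measure_iUnion_le _).trans (ENNReal.tsum_le_tsum hexcess)
    _ < ENNReal.ofReal ε := hηsum
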